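/- Let n ≥ 1 and j ≥ 0 be integers and set d := gcd(n, j). Then the evaluation of the Gaussian binomial polynomial [2n, n]_q at q = ξ_n^j equals the central binomial coefficient C(2d, d). -/

import Mathlib

/-- The Gaussian (q-)binomial coefficient `[n, k]_q` as a polynomial in `ℤ[q]`,
defined by `[n, 0] = 1`, `[0, k+1] = 0` and
`[n+1, k+1] = [n, k] + q^(k+1) * [n, k+1]` (so `[n, k] = 0` for `k > n`). -/
noncomputable def gaussBinom : ℕ → ℕ → Polynomial ℤ
  | _, 0 => 1
  | 0, _ + 1 => 0
  | n + 1, k + 1 => gaussBinom n k + Polynomial.X ^ (k + 1) * gaussBinom n (k + 1)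

theorem gaussBinom_zero_right (n : ℕ) : gaussBinom n 0 = 1 := by
  cases n <;> rfl

theorem gaussBinom_succ_succ (n k : ℕ) :
    gaussBinom (n + 1) (k + 1) =
      gaussBinom n k + Polynomial.X ^ (k + 1) * gaussBinom n (k + 1) := rfl

theorem gaussBinom_eq_zero_of_lt {n k : ℕ} (h : n < k) : gaussBinom n k = 0 := by
  induction n generalizing k with
  | zero =>
    obtain ⟨k, rfl⟩ := Nat.exists_eq_succ_of_ne_zero h.ne'
    rfl
  | succ n ih =>
    obtain ⟨k, rfl⟩ := Nat.exists_eq_succ_of_ne_zero (Nat.ne_zero_of_lt h)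
    rw [Nat.succ_eq_add_one, gaussBinom_succ_succ, ih (by omega), ih (by omega)]
    simp

theorem gaussBinom_self (n : ℕ) : gaussBinom n n = 1 := by
  induction n with
  | zero => rfl
  | succ n ih => simp [gaussBinom_succ_succ, ih, gaussBinom_eq_zero_of_lt]

theorem one_sub_X_pow_mul_gaussBinom_succ_succ (n k : ℕ) :
    (1 - Polynomial.X ^ (k + 1)) * gaussBinom (n + 1) (k + 1) =
      (1 - Polynomial.X ^ (n + 1)) * gaussBinom n k := by
  induction n generalizing k with
  | zero =>
    cases k with
    | zero => simp [gaussBinom_self]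
    | succ k => simp [gaussBinom_eq_zero_of_lt]
  | succ n ih =>
    have h := ih k
    rw [gaussBinom_succ_succ (n + 1) k]
    cases k with
    | zero =>
      simp only [gaussBinom_zero_right] at h ⊢
      linear_combination Polynomial.X * h
    | succ k =>
      have h' := ih k
      have hr := gaussBinom_succ_succ n k
      linear_combination Polynomial.X ^ (k + 2) * h + Polynomial.X * h'
        - Polynomial.X * (1 - Polynomial.X ^ (n + 1)) * hr

section RootOfUnity

variable {R : Type*} [CommRing R] [IsDomain R] {ω : R} {m : ℕ}

theorem IsPrimitiveRoot.aeval_gaussBinom_eq_zero (hω : IsPrimitiveRoot ω m) {k : ℕ}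
    (hk : k ≠ 0) (hkm : k < m) : Polynomial.aeval ω (gaussBinom m k) = 0 := by
  obtain ⟨k, rfl⟩ := Nat.exists_eq_succ_of_ne_zero hk
  obtain ⟨m, rfl⟩ := Nat.exists_eq_succ_of_ne_zero (Nat.ne_zero_of_lt hkm)
  have h := congrArg (Polynomial.aeval ω) (one_sub_X_pow_mul_gaussBinom_succ_succ m k)
  simp only [map_mul, map_sub, map_one, map_pow, Polynomial.aeval_X] at h
  rw [show ω ^ (m + 1) = 1 from hω.pow_eq_one, sub_self, zero_mul] at h
  refine (mul_eq_zero.mp h).resolve_left fun h0 => ?_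
  exact hω.pow_ne_one_of_pos_of_lt hk hkm (sub_eq_zero.mp h0).symm

theorem IsPrimitiveRoot.aeval_gaussBinom_add (hω : IsPrimitiveRoot ω m) (hm : m ≠ 0) (n : ℕ) :
    (∀ k < m, Polynomial.aeval ω (gaussBinom (n + m) k) = Polynomial.aeval ω (gaussBinom n k)) ∧
    ∀ k, Polynomial.aeval ω (gaussBinom (n + m) (k + m)) =
      Polynomial.aeval ω (gaussBinom n (k + m)) + Polynomial.aeval ω (gaussBinom n k) := by
  induction n with
  | zero =>
    constructor
    · intro k hk
      rcases Nat.eq_zero_or_pos k with rfl | h0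
      · simp [gaussBinom_zero_right]
      · rw [zero_add, hω.aeval_gaussBinom_eq_zero h0.ne' hk, gaussBinom_eq_zero_of_lt h0, map_zero]
    · intro k
      rw [gaussBinom_eq_zero_of_lt (show 0 < k + m by omega)]
      rcases Nat.eq_zero_or_pos k with rfl | h0
      · simp [gaussBinom_self]
      · rw [gaussBinom_eq_zero_of_lt (show 0 + m < k + m by omega), gaussBinom_eq_zero_of_lt h0]
        simp
  | succ n ih =>
    obtain ⟨ih₁, ih₂⟩ := ih
    have hp : ω ^ m = 1 := hω.pow_eq_one
    rw [show n + 1 + m = n + m + 1 by omega]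
    constructor
    · intro k hk
      cases k with
      | zero => simp [gaussBinom_zero_right]
      | succ k =>
        simp only [gaussBinom_succ_succ, map_add, map_mul, map_pow, Polynomial.aeval_X,
          ih₁ k (by omega), ih₁ (k + 1) hk]
    · intro k
      cases k with
      | zero =>
        obtain ⟨l, rfl⟩ := Nat.exists_eq_succ_of_ne_zero hm
        have h := ih₂ 0
        simp only [zero_add, Nat.succ_eq_add_one, gaussBinom_zero_right] at h hp ⊢
        simp only [gaussBinom_succ_succ _ l, map_add, map_mul, map_pow, Polynomial.aeval_X,
          ih₁ l (by omega), h, hp]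
        ring
      | succ k =>
        have h := ih₂ (k + 1)
        rw [show k + 1 + m = k + m + 1 by omega] at h ⊢
        simp only [gaussBinom_succ_succ, map_add, map_mul, map_pow, Polynomial.aeval_X, ih₂ k, h]
        rw [show ω ^ (k + m + 1) = ω ^ (k + 1) by rw [add_right_comm, pow_add, hp, mul_one]]
        ring

theorem IsPrimitiveRoot.aeval_gaussBinom_mul (hω : IsPrimitiveRoot ω m) (hm : m ≠ 0) (a c : ℕ) :
    Polynomial.aeval ω (gaussBinom (m * a) (m * c)) = (a.choose c : R) := by
  induction a generalizing c with
  | zero =>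
    cases c with
    | zero => simp [gaussBinom_zero_right]
    | succ c =>
      rw [gaussBinom_eq_zero_of_lt (Nat.mul_lt_mul_of_pos_left c.succ_pos (by omega))]
      simp
  | succ a ih =>
    cases c with
    | zero => simp [gaussBinom_zero_right]
    | succ c =>
      have h := ih (c + 1)
      rw [mul_add_one] at h ⊢
      rw [mul_add_one, (hω.aeval_gaussBinom_add hm _).2, h, ih, Nat.choose_succ_succ, Nat.cast_add,
        add_comm]

end RootOfUnity

/-- for `n ≥ 1`, `j ≥ 0` and `d = gcd(n, j)`, the value of `[2n, n]_q`
at `q = ξ_n^j` is the central binomial coefficient `C(2d, d)`. -/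
theorem stmt11 (n j : ℕ) (hn : 1 ≤ n) :
    Polynomial.aeval (Complex.exp (2 * Real.pi * Complex.I / n) ^ j)
      (gaussBinom (2 * n) n)
    = ((2 * Nat.gcd n j).choose (Nat.gcd n j) : ℂ) := by
  have hξ := Complex.isPrimitiveRoot_exp n (by omega)
  have hω := IsPrimitiveRoot.orderOf (Complex.exp (2 * Real.pi * Complex.I / n) ^ j)
  have ho : orderOf (Complex.exp (2 * Real.pi * Complex.I / n) ^ j) = n / n.gcd j := by
    rw [(hξ.isOfFinOrder (by omega)).orderOf_pow, ← hξ.eq_orderOf]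
  rw [ho] at hω
  have hmul : n / n.gcd j * n.gcd j = n := Nat.div_mul_cancel (Nat.gcd_dvd_left n j)
  have hm : n / n.gcd j ≠ 0 := by
    intro h
    rw [h, zero_mul] at hmul
    omega
  have key := hω.aeval_gaussBinom_mul hm (2 * n.gcd j) (n.gcd j)
  rwa [mul_left_comm, hmul] at key
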